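/- Assume the Trudinger–Moser property holds with some constant ω ∈ (0,π] and that f satisfies hypotheses (H). Then the functional φ satisfies the Palais–Smale condition at every level c ∈ ℝ. -/

import Mathlib

open MeasureTheory Real Set Filter Topology

noncomputable section

/-- Integrand of the squared Gagliardo `H^{1/2}` seminorm on `ℝ`. -/
def gagKer (u : ℝ → ℝ) : ℝ × ℝ → ℝ :=
  fun p => (u p.1 - u p.2) ^ 2 / |p.1 - p.2| ^ 2

/-- Integrand of the Gagliardo inner product `⟨u,v⟩_X`. -/
def innerKer (u v : ℝ → ℝ) : ℝ × ℝ → ℝ :=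
  fun p => (u p.1 - u p.2) * (v p.1 - v p.2) / |p.1 - p.2| ^ 2

/-- `u ∈ H^{1/2}(ℝ)` : `u ∈ L²(ℝ)` with finite Gagliardo seminorm. -/
def memH (u : ℝ → ℝ) : Prop :=
  Measurable u ∧ Integrable (fun x => (u x) ^ 2) ∧ Integrable (gagKer u)

/-- Squared Gagliardo seminorm `[u]²`. -/
def gagSq (u : ℝ → ℝ) : ℝ := ∫ p : ℝ × ℝ, gagKer u p

/-- Gagliardo seminorm `[u]`, i.e. the norm `‖u‖_X`. -/
def gagNorm (u : ℝ → ℝ) : ℝ := Real.sqrt (gagSq u)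

/-- Inner product `⟨u, v⟩_X`. -/
def innerX (u v : ℝ → ℝ) : ℝ := ∫ p : ℝ × ℝ, innerKer u v p

/-- `u ∈ X` : `u ∈ H^{1/2}(ℝ)` and `u = 0` a.e. outside `(0,1)`. -/
def memX (u : ℝ → ℝ) : Prop :=
  memH u ∧ ∀ᵐ x : ℝ, x ∉ Ioo (0 : ℝ) 1 → u x = 0

/-- `λ₁ = inf {[u]² : u ∈ X, ‖u‖_{L²(0,1)} = 1}`. -/
def lam1 : ℝ :=
  sInf { t : ℝ | ∃ u : ℝ → ℝ, memX u ∧ (∫ x in Ioo (0 : ℝ) 1, (u x) ^ 2) = 1 ∧ gagSq u = t }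

/-- Trudinger–Moser property with constant `ω`. -/
def TMprop (ω : ℝ) : Prop :=
  ∀ α : ℝ, 0 < α → α < 2 * π * ω →
    ∃ K : ℝ, 0 < K ∧ ∀ u : ℝ → ℝ, memX u → gagNorm u ≤ 1 →
      (∫⁻ x in Ioo (0 : ℝ) 1, ENNReal.ofReal (exp (α * (u x) ^ 2))) ≤ ENNReal.ofReal K

/-- The primitive `F(t) = ∫₀ᵗ f(τ) dτ`. -/
def primF (f : ℝ → ℝ) : ℝ → ℝ := fun t => ∫ τ in (0 : ℝ)..t, f τ

/-- Hypotheses (H). -/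
def HypH (f : ℝ → ℝ) : Prop :=
  Continuous f ∧ f 0 = 0 ∧
  (∃ t₀ > (0 : ℝ), ∃ M > (0 : ℝ),
    ∀ t : ℝ, t₀ ≤ |t| → 0 < primF f t ∧ primF f t ≤ M * |f t|) ∧
  (∀ t : ℝ, t ≠ 0 → 0 < 2 * primF f t ∧ 2 * primF f t ≤ f t * t) ∧
  (Filter.limsup (fun t => primF f t / t ^ 2) (𝓝[≠] (0 : ℝ)) < lam1 / (4 * π)) ∧
  (∀ α : ℝ, 0 < α →
    Filter.Tendsto (fun t => |f t| * exp (-α * t ^ 2)) (Filter.cocompact ℝ) (𝓝 0))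

/-- Hypotheses (H') with Trudinger–Moser constant `ω`. -/
def HypH' (f : ℝ → ℝ) (ω : ℝ) : Prop :=
  Continuous f ∧ f 0 = 0 ∧
  (∃ t₀ > (0 : ℝ), ∃ M > (0 : ℝ),
    ∀ t : ℝ, t₀ ≤ |t| → 0 < primF f t ∧ primF f t ≤ M * |f t|) ∧
  (∀ t : ℝ, t ≠ 0 → 0 < 2 * primF f t ∧ 2 * primF f t ≤ f t * t) ∧
  (Filter.limsup (fun t => primF f t / t ^ 2) (𝓝[≠] (0 : ℝ)) < lam1 / (4 * π)) ∧
  ∃ α₀ : ℝ, 0 < α₀ ∧ α₀ < 2 * π * ω ∧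
    (∀ α : ℝ, 0 < α → α < α₀ →
      Filter.Tendsto (fun t => |f t| * exp (-α * t ^ 2)) (Filter.cocompact ℝ) Filter.atTop) ∧
    (∀ α : ℝ, α₀ < α →
      Filter.Tendsto (fun t => |f t| * exp (-α * t ^ 2)) (Filter.cocompact ℝ) (𝓝 0)) ∧
    ∃ ψ : ℝ → ℝ, memX ψ ∧ gagNorm ψ = 1 ∧
      ∃ b : ℝ, b < ω / (2 * α₀) ∧ ∀ t : ℝ, 0 < t →
        t ^ 2 / (4 * π) - (∫ x in Ioo (0 : ℝ) 1, primF f (t * ψ x)) ≤ b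

/-- `u` is a (weak) solution of `(-Δ)^{1/2} u = f(u)` in `(0,1)`, `u = 0` outside. -/
def IsWeakSolution (f u : ℝ → ℝ) : Prop :=
  memX u ∧ ∀ v : ℝ → ℝ, memX v →
    IntegrableOn (fun x => f (u x) * v x) (Ioo (0 : ℝ) 1) ∧
    innerX u v / (2 * π) = ∫ x in Ioo (0 : ℝ) 1, f (u x) * v x

/-- The energy functional `φ(u) = ‖u‖_X²/(4π) - ∫₀¹ F(u) dx`. -/
def phi (f u : ℝ → ℝ) : ℝ :=
  gagSq u / (4 * π) - ∫ x in Ioo (0 : ℝ) 1, primF f (u x)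

/-- `⟨φ'(u), v⟩ = (1/(2π))⟨u,v⟩_X - ∫₀¹ f(u) v dx`. -/
def phiDeriv (f u v : ℝ → ℝ) : ℝ :=
  innerX u v / (2 * π) - ∫ x in Ioo (0 : ℝ) 1, f (u x) * v x

/-- The Palais–Smale condition at level `c`. -/
def PalaisSmaleAt (f : ℝ → ℝ) (c : ℝ) : Prop :=
  ∀ u : ℕ → ℝ → ℝ, (∀ n, memX (u n)) →
    Filter.Tendsto (fun n => phi f (u n)) Filter.atTop (𝓝 c) →
    (∃ ε : ℕ → ℝ, Filter.Tendsto ε Filter.atTop (𝓝 0) ∧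
      ∀ n, ∀ v : ℝ → ℝ, memX v → gagNorm v ≤ 1 → |phiDeriv f (u n) v| ≤ ε n) →
    ∃ w : ℝ → ℝ, memX w ∧ ∃ g : ℕ → ℕ, StrictMono g ∧
      Filter.Tendsto (fun k => gagNorm (fun x => u (g k) x - w x)) Filter.atTop (𝓝 0)


lemma gagKer_nonneg (u : ℝ → ℝ) (p : ℝ × ℝ) : 0 ≤ gagKer u p := by
  unfold gagKer; positivity

lemma gagKer_meas {u : ℝ → ℝ} (hu : Measurable u) : Measurable (gagKer u) := by
  unfold gagKer
  simp only [sq_abs]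
  fun_prop

lemma gagSq_nonneg (u : ℝ → ℝ) : 0 ≤ gagSq u := integral_nonneg (gagKer_nonneg u)

lemma gagNorm_sq (u : ℝ → ℝ) : gagNorm u ^ 2 = gagSq u := Real.sq_sqrt (gagSq_nonneg u)

lemma gagKer_smul (c : ℝ) (u : ℝ → ℝ) (p : ℝ × ℝ) :
    gagKer (fun x => c * u x) p = c ^ 2 * gagKer u p := by
  unfold gagKer; ring

lemma gagSq_smul (c : ℝ) (u : ℝ → ℝ) : gagSq (fun x => c * u x) = c ^ 2 * gagSq u := by
  unfold gagSq
  simp_rw [gagKer_smul]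
  rw [integral_const_mul]

lemma gagNorm_smul {c : ℝ} (hc : 0 ≤ c) (u : ℝ → ℝ) :
    gagNorm (fun x => c * u x) = c * gagNorm u := by
  unfold gagNorm
  rw [gagSq_smul, Real.sqrt_mul (sq_nonneg c), Real.sqrt_sq hc]

lemma gagKer_sub_le (u v : ℝ → ℝ) (p : ℝ × ℝ) :
    gagKer (fun x => u x - v x) p ≤ 2 * gagKer u p + 2 * gagKer v p := by
  unfold gagKer
  rw [← mul_div_assoc, ← mul_div_assoc, ← add_div]
  gcongr
  nlinarith [sq_nonneg ((u p.1 - u p.2) + (v p.1 - v p.2))]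

lemma memX_smul {u : ℝ → ℝ} (hu : memX u) (c : ℝ) : memX (fun x => c * u x) := by
  obtain ⟨⟨h1, h2, h3⟩, h4⟩ := hu
  refine ⟨⟨by fun_prop, ?_, ?_⟩, ?_⟩
  · simpa [mul_pow] using h2.const_mul (c ^ 2)
  · have := h3.const_mul (c ^ 2)
    refine this.congr (ae_of_all _ fun p => (gagKer_smul c u p).symm)
  · filter_upwards [h4] with x hx h
    rw [hx h, mul_zero]

lemma memX_sub {u v : ℝ → ℝ} (hu : memX u) (hv : memX v) : memX (fun x => u x - v x) := by
  obtain ⟨⟨h1, h2, h3⟩, h4⟩ := hu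
  obtain ⟨⟨k1, k2, k3⟩, k4⟩ := hv
  refine ⟨⟨by fun_prop, ?_, ?_⟩, ?_⟩
  · refine Integrable.mono' ((h2.const_mul 2).add (k2.const_mul 2)) (by fun_prop)
      (ae_of_all _ fun x => ?_)
    simp only [Pi.add_apply]
    rw [Real.norm_of_nonneg (sq_nonneg _)]
    nlinarith [sq_nonneg (u x + v x)]
  · refine Integrable.mono' ((h3.const_mul 2).add (k3.const_mul 2))
      (gagKer_meas (by fun_prop)).aestronglyMeasurable (ae_of_all _ fun x => ?_)
    rw [Real.norm_of_nonneg (gagKer_nonneg _ _)]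
    exact gagKer_sub_le u v x
  · filter_upwards [h4, k4] with x hx kx h
    rw [hx h, kx h, sub_zero]

lemma gagSq_sub_le {u v : ℝ → ℝ} (hu : memX u) (hv : memX v) :
    gagSq (fun x => u x - v x) ≤ 2 * gagSq u + 2 * gagSq v := by
  unfold gagSq
  rw [← integral_const_mul, ← integral_const_mul, ← integral_add]
  · exact integral_mono (memX_sub hu hv).1.2.2
      ((hu.1.2.2.const_mul 2).add (hv.1.2.2.const_mul 2)) (gagKer_sub_le u v)
  · exact hu.1.2.2.const_mul 2
  · exact hv.1.2.2.const_mul 2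

lemma innerKer_integrable {u v : ℝ → ℝ} (hu : memX u) (hv : memX v) :
    Integrable (innerKer u v) := by
  have h1 := hu.1.1
  have h2 := hv.1.1
  refine Integrable.mono' (hu.1.2.2.add hv.1.2.2) ?_ (ae_of_all _ fun p => ?_)
  · apply Measurable.aestronglyMeasurable
    unfold innerKer
    simp only [sq_abs]
    fun_prop
  · simp only [Pi.add_apply, innerKer, gagKer]
    rw [Real.norm_eq_abs, abs_div, abs_of_nonneg (sq_nonneg |p.1 - p.2|), ← add_div]
    gcongr
    rw [abs_le]
    constructor <;>
    nlinarith [sq_nonneg ((u p.1 - u p.2) + (v p.1 - v p.2)),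
      sq_nonneg ((u p.1 - u p.2) - (v p.1 - v p.2)), sq_nonneg (u p.1 - u p.2),
      sq_nonneg (v p.1 - v p.2)]

lemma innerX_self (u : ℝ → ℝ) : innerX u u = gagSq u := by
  unfold innerX gagSq innerKer gagKer
  simp only [pow_two]

lemma innerX_sub_sub {u v : ℝ → ℝ} (hu : memX u) (hv : memX v) :
    innerX u (fun x => u x - v x) - innerX v (fun x => u x - v x)
      = gagSq (fun x => u x - v x) := by
  rw [← innerX_self]
  unfold innerX
  rw [← integral_sub (innerKer_integrable hu (memX_sub hu hv))
    (innerKer_integrable hv (memX_sub hu hv))]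
  congr 1
  ext p
  unfold innerKer
  ring

lemma phiDeriv_smul (f u v : ℝ → ℝ) (c : ℝ) :
    phiDeriv f u (fun x => c * v x) = c * phiDeriv f u v := by
  unfold phiDeriv innerX
  have h1 : ∀ p, innerKer u (fun x => c * v x) p = c * innerKer u v p := by
    intro p; unfold innerKer; ring
  have h2 : ∀ x, f (u x) * (c * v x) = c * (f (u x) * v x) := by intro x; ring
  simp_rw [h1, h2]
  rw [integral_const_mul, integral_const_mul]
  ring

lemma phiDeriv_bound {f u : ℝ → ℝ} {e : ℝ}
    (h : ∀ v : ℝ → ℝ, memX v → gagNorm v ≤ 1 → |phiDeriv f u v| ≤ e)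
    {v : ℝ → ℝ} (hv : memX v) {R : ℝ} (hR : 0 < R) (hvR : gagNorm v ≤ R) :
    |phiDeriv f u v| ≤ e * R := by
  have := h (fun x => R⁻¹ * v x) (memX_smul hv _) (by
    rw [gagNorm_smul (by positivity), inv_mul_le_iff₀ hR]; simpa using hvR)
  rw [phiDeriv_smul, abs_mul, abs_of_pos (inv_pos.2 hR), inv_mul_le_iff₀ hR] at this
  linarith

lemma f_growth {f : ℝ → ℝ} (hf : HypH f) {α : ℝ} (hα : 0 < α) :
    ∃ C > 0, ∀ t, |f t| ≤ C * exp (α * t ^ 2) := by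
  have hc := hf.1
  have h := hf.2.2.2.2.2 α hα
  have h1 := h.eventually (gt_mem_nhds (zero_lt_one))
  obtain ⟨K, hK, hK'⟩ := Filter.mem_cocompact.1 h1
  obtain ⟨B, hB⟩ := hK.exists_bound_of_continuousOn (f := fun t => |f t| * exp (-α * t ^ 2))
    (by fun_prop)
  refine ⟨max B 1, by positivity, fun t => ?_⟩
  have key : |f t| * exp (-α * t ^ 2) ≤ max B 1 := by
    by_cases ht : t ∈ K
    · exact le_max_of_le_left ((le_abs_self _).trans (hB t ht))
    · exact le_max_of_le_right (le_of_lt (hK' ht))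
  calc |f t| = (|f t| * exp (-α * t ^ 2)) * exp (α * t ^ 2) := by
        rw [mul_assoc, ← exp_add]; simp
    _ ≤ _ := by gcongr

lemma exp_bound {ω : ℝ} (hω0 : 0 < ω) (hTM : TMprop ω) {R : ℝ} (hR : 0 < R) :
    ∃ α > 0, ∃ K > 0, ∀ u, memX u → gagNorm u ≤ R →
      IntegrableOn (fun x => exp (α * u x ^ 2)) (Ioo 0 1) ∧
      ∫ x in Ioo (0:ℝ) 1, exp (α * u x ^ 2) ≤ K := by
  have hπ := Real.pi_pos
  obtain ⟨K, hK, h⟩ := hTM (π * ω) (by positivity) (by nlinarith [mul_pos hπ hω0])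
  refine ⟨π * ω / R ^ 2, by positivity, K, hK, fun u hu huR => ?_⟩
  have := h (fun x => R⁻¹ * u x) (memX_smul hu _) (by
    rw [gagNorm_smul (by positivity), inv_mul_le_iff₀ hR]; simpa using huR)
  have e : ∀ x, π * ω * (R⁻¹ * u x) ^ 2 = π * ω / R ^ 2 * u x ^ 2 := by
    intro x; field_simp
  simp_rw [e] at this
  have hm : Measurable (fun x => exp (π * ω / R ^ 2 * u x ^ 2)) := by
    have := hu.1.1
    fun_prop
  have hi : IntegrableOn (fun x => exp (π * ω / R ^ 2 * u x ^ 2)) (Ioo 0 1) := by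
    refine ⟨hm.aestronglyMeasurable, ?_⟩
    rw [hasFiniteIntegral_iff_ofReal (ae_of_all _ fun x => (exp_pos _).le)]
    exact this.trans_lt ENNReal.ofReal_lt_top
  refine ⟨hi, ?_⟩
  rw [← ofReal_integral_eq_lintegral_ofReal hi (ae_of_all _ fun x => (exp_pos _).le)] at this
  exact (ENNReal.ofReal_le_ofReal_iff hK.le).1 this

lemma sq_bounds {ω : ℝ} (hω0 : 0 < ω) (hTM : TMprop ω) {f : ℝ → ℝ} (hf : HypH f)
    {R : ℝ} (hR : 0 < R) :
    ∃ K > 0, ∀ u, memX u → gagNorm u ≤ R →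
      ∫ x in Ioo (0:ℝ) 1, u x ^ 2 ≤ K ∧
      IntegrableOn (fun x => f (u x) ^ 2) (Ioo 0 1) ∧
      ∫ x in Ioo (0:ℝ) 1, f (u x) ^ 2 ≤ K := by
  obtain ⟨α, hα, K, hK, h⟩ := exp_bound hω0 hTM hR
  obtain ⟨C, hC, hf'⟩ := f_growth hf (half_pos hα)
  refine ⟨α⁻¹ * K + C ^ 2 * K, by positivity, fun u hu huR => ?_⟩
  obtain ⟨h1, h2⟩ := h u hu huR
  have hm := hu.1.1
  have hfc := hf.1
  have b1 : ∀ x, u x ^ 2 ≤ α⁻¹ * exp (α * u x ^ 2) := by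
    intro x
    rw [le_inv_mul_iff₀ hα]
    linarith [add_one_le_exp (α * u x ^ 2)]
  have b2 : ∀ x, f (u x) ^ 2 ≤ C ^ 2 * exp (α * u x ^ 2) := by
    intro x
    have := pow_le_pow_left₀ (abs_nonneg _) (hf' (u x)) 2
    rw [sq_abs, mul_pow, ← exp_nat_mul] at this
    have e : α * u x ^ 2 = ((2:ℕ):ℝ) * (α / 2 * u x ^ 2) := by push_cast; ring
    rw [e]
    exact this
  have i2 : IntegrableOn (fun x => f (u x) ^ 2) (Ioo 0 1) := by
    refine Integrable.mono' (h1.const_mul (C ^ 2)) (by fun_prop) (ae_of_all _ fun x => ?_)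
    rw [Real.norm_of_nonneg (sq_nonneg _)]
    exact b2 x
  refine ⟨?_, i2, ?_⟩
  · calc ∫ x in Ioo (0:ℝ) 1, u x ^ 2 ≤ ∫ x in Ioo (0:ℝ) 1, α⁻¹ * exp (α * u x ^ 2) :=
          integral_mono hu.1.2.1.integrableOn (h1.const_mul _) b1
      _ ≤ α⁻¹ * K := by rw [integral_const_mul]; gcongr
      _ ≤ _ := by nlinarith [mul_pos (pow_pos hC 2) hK]
  · calc ∫ x in Ioo (0:ℝ) 1, f (u x) ^ 2 ≤ ∫ x in Ioo (0:ℝ) 1, C ^ 2 * exp (α * u x ^ 2) :=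
          integral_mono i2 (h1.const_mul _) b2
      _ ≤ C ^ 2 * K := by rw [integral_const_mul]; gcongr
      _ ≤ _ := by nlinarith [mul_pos (inv_pos.2 hα) hK]

lemma primF_cont {f : ℝ → ℝ} (hf : Continuous f) : Continuous (primF f) :=
  intervalIntegral.continuous_primitive (fun a b => hf.intervalIntegrable a b) 0

lemma primF_zero (f : ℝ → ℝ) : primF f 0 = 0 := by simp [primF]

lemma primF_bound {f : ℝ → ℝ} (hf : HypH f) :
    ∃ C > 0, ∀ t, 0 ≤ primF f t ∧ 0 ≤ f t * t ∧ primF f t ≤ C + f t * t / 4 := by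
  obtain ⟨hc, h0, ⟨t₀, ht₀, M, hM, h1⟩, h2, -⟩ := hf
  have pos : ∀ t, 0 ≤ primF f t ∧ 0 ≤ f t * t := by
    intro t
    by_cases ht : t = 0
    · subst ht; simp [primF_zero]
    · have := h2 t ht
      constructor <;> linarith
  set T := max t₀ (4 * M)
  obtain ⟨B, hB⟩ := (isCompact_Icc (a := -T) (b := T)).exists_bound_of_continuousOn
    (f := primF f) (primF_cont hc).continuousOn
  refine ⟨max B 1, by positivity, fun t => ⟨(pos t).1, (pos t).2, ?_⟩⟩
  by_cases ht : |t| ≤ T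
  · have := (le_abs_self _).trans (hB t (abs_le.1 ht))
    linarith [le_max_left B 1, (pos t).2]
  · push Not at ht
    have a1 := h1 t ((le_max_left _ _).trans ht.le)
    have a2 : 4 * M ≤ |t| := (le_max_right _ _).trans ht.le
    have a3 : f t * t = |f t| * |t| := by rw [← abs_mul, abs_of_nonneg (pos t).2]
    have : 4 * M * |f t| ≤ |t| * |f t| := by gcongr
    rw [a3]
    linarith [le_max_right B 1]

lemma ps_bounded {ω : ℝ} (hω0 : 0 < ω) (hTM : TMprop ω) {f : ℝ → ℝ} (hf : HypH f)
    (A E : ℝ) (hE : 0 ≤ E) :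
    ∃ R > 0, ∀ u, memX u → phi f u ≤ A →
      (∀ v : ℝ → ℝ, memX v → gagNorm v ≤ 1 → |phiDeriv f u v| ≤ E) → gagNorm u ≤ R := by
  obtain ⟨C, hC, hF⟩ := primF_bound hf
  have hπ := Real.pi_pos
  set P := 8 * π * (|A| + C + E / 4)
  set Q := 8 * π * (E / 4)
  have hP : 0 ≤ P := by positivity
  have hQ : 0 ≤ Q := by positivity
  refine ⟨P + Q + 1, by positivity, fun u hu hA hv => ?_⟩
  set s := gagNorm u with hs
  have hs0 : 0 ≤ s := Real.sqrt_nonneg _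
  have d := phiDeriv_bound hv hu (R := s + 1) (by positivity) (by linarith)
  obtain ⟨K, -, hK⟩ := sq_bounds hω0 hTM hf (R := s + 1) (by positivity)
  obtain ⟨-, i2, -⟩ := hK u hu (by linarith)
  have hm := hu.1.1
  have hfc := hf.1
  have hFc := primF_cont hfc
  have i3 : IntegrableOn (fun x => f (u x) * u x) (Ioo 0 1) := by
    refine Integrable.mono' (i2.add hu.1.2.1.integrableOn) (by fun_prop)
      (ae_of_all _ fun x => ?_)
    simp only [Pi.add_apply]
    rw [Real.norm_of_nonneg (hF (u x)).2.1]
    nlinarith [sq_nonneg (f (u x) - u x), sq_nonneg (f (u x)), sq_nonneg (u x)]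
  have i5 : IntegrableOn (fun x => C + f (u x) * u x / 4) (Ioo 0 1) :=
    Integrable.add (integrable_const _) (Integrable.div_const i3 _)
  have i4 : IntegrableOn (fun x => primF f (u x)) (Ioo 0 1) := by
    refine Integrable.mono' i5 (by fun_prop) (ae_of_all _ fun x => ?_)
    rw [Real.norm_of_nonneg (hF (u x)).1]
    exact (hF (u x)).2.2
  have key : ∫ x in Ioo (0:ℝ) 1, primF f (u x) ≤ C + (∫ x in Ioo (0:ℝ) 1, f (u x) * u x) / 4 := by
    calc _ ≤ ∫ x in Ioo (0:ℝ) 1, (C + f (u x) * u x / 4) :=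
          integral_mono i4 i5 (fun x => (hF (u x)).2.2)
      _ = _ := by
          rw [integral_add (integrable_const _) (Integrable.div_const i3 _), integral_div]
          simp
  have e1 : s ^ 2 = gagSq u := gagNorm_sq u
  unfold phi at hA
  unfold phiDeriv at d
  rw [innerX_self] at d
  rw [← e1] at hA d
  have d' := (abs_le.1 d).1
  have d2 := le_abs_self A
  have q : s ^ 2 / (8 * π) ≤ |A| + C + E * (s + 1) / 4 := by
    have x1 : s ^ 2 / (4 * π) = 2 * (s ^ 2 / (8 * π)) := by field_simp; ring
    have x2 : s ^ 2 / (2 * π) = 4 * (s ^ 2 / (8 * π)) := by field_simp; ring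
    have d'' := (abs_le.1 d).2
    rw [x1] at hA
    rw [x2] at d''  d'
    linarith
  have q2 : s ^ 2 ≤ P + Q * s := by
    rw [div_le_iff₀ (by positivity)] at q
    simp only [P, Q]
    linarith
  by_contra hcon
  push Not at hcon
  nlinarith

lemma integral_sq_eq {v : ℝ → ℝ} (hv : memX v) :
    ∫ x, v x ^ 2 = ∫ x in Ioo (0:ℝ) 1, v x ^ 2 := by
  symm
  apply setIntegral_eq_integral_of_ae_compl_eq_zero
  filter_upwards [hv.2] with x hx h
  rw [hx h]; simp

lemma intOn_of_sq {v : ℝ → ℝ} (hm : Measurable v) (hi : Integrable (fun x => v x ^ 2)) (a b : ℝ) :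
    IntegrableOn v (Ioc a b) := by
  have h2 : IntegrableOn (fun x => 1 + v x ^ 2) (Ioc a b) :=
    Integrable.add (integrable_const _) hi.integrableOn
  refine Integrable.mono' h2 hm.aestronglyMeasurable (ae_of_all _ fun x => ?_)
  rw [Real.norm_eq_abs, abs_le]
  constructor <;> nlinarith [sq_nonneg (v x + 1), sq_nonneg (v x - 1), sq_nonneg (v x)]

lemma coef_bound {v : ℝ → ℝ} (hv : memX v) {a b : ℝ} (hab : a ≤ b) :
    |∫ x in Ioc a b, v x| ≤ (b - a) + ∫ x in Ioo (0:ℝ) 1, v x ^ 2 := by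
  have hi := hv.1.2.1
  have h2 : IntegrableOn (fun x => 1 + v x ^ 2) (Ioc a b) :=
    Integrable.add (integrable_const _) hi.integrableOn
  calc |∫ x in Ioc a b, v x| ≤ ∫ x in Ioc a b, |v x| := abs_integral_le_integral_abs
    _ ≤ ∫ x in Ioc a b, (1 + v x ^ 2) := by
        refine integral_mono (intOn_of_sq hv.1.1 hi a b).abs h2 fun x => ?_
        rw [abs_le]
        constructor <;> nlinarith [sq_nonneg (v x + 1), sq_nonneg (v x - 1), sq_nonneg (v x)]
    _ = (b - a) + ∫ x in Ioc a b, v x ^ 2 := by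
        rw [integral_add (integrable_const _) hi.integrableOn]
        simp [hab]
    _ ≤ _ := by
        rw [← integral_sq_eq hv]
        exact add_le_add le_rfl
          (setIntegral_le_integral hi (ae_of_all _ fun x => sq_nonneg _))

lemma interval_ineq {v : ℝ → ℝ} (hv : memX v) {a b : ℝ} (hab : a < b) :
    ∫ x in Ioc a b, v x ^ 2 ≤ (b - a) / 2 * (∫ p in Ioc a b ×ˢ Ioc a b, gagKer v p)
      + (b - a)⁻¹ * (∫ x in Ioc a b, v x) ^ 2 := by
  have hm := hv.1.1
  have hi := hv.1.2.1
  set ν := (volume : Measure ℝ).restrict (Ioc a b) with hν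
  have hprod : (volume : Measure (ℝ × ℝ)).restrict (Ioc a b ×ˢ Ioc a b) = ν.prod ν := by
    rw [hν, Measure.prod_restrict, Measure.volume_eq_prod]
  have i1 : Integrable v ν := intOn_of_sq hm hi a b
  have i2 : Integrable (fun x => v x ^ 2) ν := hi.integrableOn
  have i0 : Integrable (fun _ : ℝ => (1:ℝ)) ν := integrable_const _
  have hone : ∫ _x, (1:ℝ) ∂ν = b - a := by simp [hν, hab.le]
  have j1 := i2.mul_prod i0
  have j2 := i0.mul_prod i2
  have j3 := i1.mul_prod i1
  have e : ∫ p, (v p.1 - v p.2) ^ 2 ∂(ν.prod ν)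
      = 2 * (b - a) * (∫ x, v x ^ 2 ∂ν) - 2 * (∫ x, v x ∂ν) ^ 2 := by
    have : ∀ p : ℝ × ℝ, (v p.1 - v p.2) ^ 2
        = (v p.1 ^ 2 * 1 + 1 * v p.2 ^ 2) - 2 * (v p.1 * v p.2) := by intro p; ring
    simp_rw [this]
    have j4 : Integrable (fun p : ℝ × ℝ => v p.1 ^ 2 * 1 + 1 * v p.2 ^ 2) (ν.prod ν) := j1.add j2
    rw [integral_sub j4 (j3.const_mul 2), integral_add j1 j2,
      integral_const_mul 2 (fun p : ℝ × ℝ => v p.1 * v p.2),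
      integral_prod_mul (fun x => v x ^ 2) (fun _ => (1:ℝ)),
      integral_prod_mul (fun _ => (1:ℝ)) (fun x => v x ^ 2), integral_prod_mul v v, hone]
    ring
  have ig : Integrable (gagKer v) (ν.prod ν) := by
    rw [← hprod]; exact hv.1.2.2.integrableOn
  have le : ∫ p, (v p.1 - v p.2) ^ 2 ∂(ν.prod ν) ≤ (b - a) ^ 2 * ∫ p, gagKer v p ∂(ν.prod ν) := by
    rw [← integral_const_mul]
    apply integral_mono_ae
    · have := (j1.add j2).sub (j3.const_mul 2)
      refine this.congr (ae_of_all _ fun p => ?_)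
      simp only [Pi.add_apply, Pi.sub_apply]
      ring
    · exact ig.const_mul _
    · rw [← hprod]
      filter_upwards [ae_restrict_mem (measurableSet_Ioc.prod measurableSet_Ioc)] with p hp
      unfold gagKer
      rcases eq_or_ne p.1 p.2 with h | h
      · simp [h]
      · have h' : 0 < |p.1 - p.2| := abs_pos.2 (sub_ne_zero.2 h)
        rw [← mul_div_assoc, le_div_iff₀ (by positivity), mul_comm]
        gcongr
        obtain ⟨⟨h1, h2⟩, h3, h4⟩ := hp
        rw [abs_le]; constructor <;> linarith
  rw [hprod]
  rw [e] at le
  have hd : 0 < b - a := sub_pos.2 hab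
  have : (b - a) * (∫ x, v x ^ 2 ∂ν) ≤ (b - a) * ((b - a) / 2 * (∫ p, gagKer v p ∂(ν.prod ν))
      + (b - a)⁻¹ * (∫ x, v x ∂ν) ^ 2) := by
    rw [mul_add, mul_inv_cancel_left₀ hd.ne']
    linarith
  exact le_of_mul_le_mul_left this hd

lemma partition_ineq {v : ℝ → ℝ} (hv : memX v) {N : ℕ} (hN : 0 < N) :
    ∫ x in Ioo (0:ℝ) 1, v x ^ 2 ≤ 1 / (2 * N) * gagSq v
      + N * ∑ j ∈ Finset.range N, (∫ x in Ioc ((j:ℝ) / N) ((j + 1 : ℝ) / N), v x) ^ 2 := by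
  have hN' : (0:ℝ) < N := by exact_mod_cast hN
  have hi := hv.1.2.1
  have lt : ∀ j : ℕ, (j:ℝ) / N < (j + 1 : ℝ) / N := fun j => by gcongr; linarith
  have len : ∀ j : ℕ, (j + 1 : ℝ) / N - (j:ℝ) / N = 1 / N := fun j => by ring
  have e1 : ∫ x in Ioo (0:ℝ) 1, v x ^ 2
      = ∑ j ∈ Finset.range N, ∫ x in Ioc ((j:ℝ) / N) ((j + 1 : ℝ) / N), v x ^ 2 := by
    have := intervalIntegral.sum_integral_adjacent_intervals (f := fun x => v x ^ 2)
      (μ := volume) (a := fun k : ℕ => (k:ℝ) / N) (n := N)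
      (fun k _ => hi.intervalIntegrable)
    simp only [Nat.cast_zero, zero_div, div_self hN'.ne'] at this
    rw [intervalIntegral.integral_of_le zero_le_one, integral_Ioc_eq_integral_Ioo] at this
    rw [← this]
    refine Finset.sum_congr rfl fun j _ => ?_
    push_cast
    rw [intervalIntegral.integral_of_le (lt j).le]
  have e2 : ∑ j ∈ Finset.range N, (∫ p in Ioc ((j:ℝ) / N) ((j + 1 : ℝ) / N) ×ˢ
      Ioc ((j:ℝ) / N) ((j + 1 : ℝ) / N), gagKer v p) ≤ gagSq v := by
    rw [← integral_biUnion_finset]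
    · exact setIntegral_le_integral hv.1.2.2 (ae_of_all _ (gagKer_nonneg v))
    · intro j _
      exact measurableSet_Ioc.prod measurableSet_Ioc
    · intro i _ j _ hij
      rw [Function.onFun, Set.disjoint_left]
      rintro p ⟨⟨h1, h2⟩, -⟩ ⟨⟨h3, h4⟩, -⟩
      have a1 := h1.trans_le h4
      have a2 := h3.trans_le h2
      rw [div_lt_div_iff_of_pos_right hN'] at a1 a2
      norm_cast at a1 a2
      omega
    · intro j _
      exact hv.1.2.2.integrableOn
  rw [e1]
  calc _ ≤ ∑ j ∈ Finset.range N, (1 / (2 * N) * (∫ p in Ioc ((j:ℝ) / N) ((j + 1 : ℝ) / N) ×ˢ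
      Ioc ((j:ℝ) / N) ((j + 1 : ℝ) / N), gagKer v p)
        + N * (∫ x in Ioc ((j:ℝ) / N) ((j + 1 : ℝ) / N), v x) ^ 2) := by
        refine Finset.sum_le_sum fun j _ => ?_
        have := interval_ineq hv (lt j)
        rw [len] at this
        have c1 : 1 / (N:ℝ) / 2 = 1 / (2 * N) := by ring
        have c2 : (1 / (N:ℝ))⁻¹ = N := by simp
        rw [c1, c2] at this
        exact this
    _ ≤ _ := by
        rw [Finset.sum_add_distrib, ← Finset.mul_sum, ← Finset.mul_sum]
        gcongr

lemma compact_emb {u : ℕ → ℝ → ℝ} (hu : ∀ n, memX (u n)) {R K : ℝ}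
    (hR : ∀ n, gagSq (u n) ≤ R) (hK : ∀ n, ∫ x in Ioo (0:ℝ) 1, u n x ^ 2 ≤ K) :
    ∃ g : ℕ → ℕ, StrictMono g ∧ ∀ ε > 0, ∃ k₀, ∀ k ≥ k₀, ∀ l ≥ k₀,
      ∫ x in Ioo (0:ℝ) 1, (u (g k) x - u (g l) x) ^ 2 < ε := by
  let X : ℕ → (ℕ × ℕ → ℝ) := fun n q =>
    ∫ x in Ioc ((q.2:ℝ) / q.1) ((q.2 + 1 : ℝ) / q.1), u n x
  have hc : IsCompact (Set.univ.pi fun q : ℕ × ℕ => Icc (-(1 / (q.1:ℝ) + K)) (1 / (q.1:ℝ) + K)) :=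
    isCompact_univ_pi fun q => isCompact_Icc
  have hX : ∀ n, X n ∈ Set.univ.pi fun q : ℕ × ℕ =>
      Icc (-(1 / (q.1:ℝ) + K)) (1 / (q.1:ℝ) + K) := by
    intro n q _
    have hq : (q.2:ℝ) / q.1 ≤ (q.2 + 1 : ℝ) / q.1 := by gcongr; linarith
    have := coef_bound (hu n) hq
    refine abs_le.1 (this.trans ?_)
    have e : (q.2 + 1 : ℝ) / q.1 - (q.2:ℝ) / q.1 = 1 / q.1 := by ring
    rw [e]
    gcongr
    exact hK n
  obtain ⟨a, -, g, hg, hlim⟩ := hc.tendsto_subseq hX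
  refine ⟨g, hg, fun ε hε => ?_⟩
  have hR0 : 0 ≤ R := (gagSq_nonneg _).trans (hR 0)
  obtain ⟨N, hN⟩ := exists_nat_gt (4 * R / ε)
  have hN' : (0:ℝ) < N := lt_of_le_of_lt (by positivity) hN
  have hN0 : 0 < N := by exact_mod_cast hN'
  have t1 : Tendsto (fun p : ℕ × ℕ => (N:ℝ) * ∑ j ∈ Finset.range N,
      (X (g p.1) (N, j) - X (g p.2) (N, j)) ^ 2) (atTop ×ˢ atTop) (𝓝 0) := by
    have h1 : ∀ j, Tendsto (fun k => X (g k) (N, j)) atTop (𝓝 (a (N, j))) :=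
      fun j => (tendsto_pi_nhds.1 hlim) (N, j)
    have h2 : ∀ j, Tendsto (fun p : ℕ × ℕ => (X (g p.1) (N, j) - X (g p.2) (N, j)) ^ 2)
        (atTop ×ˢ atTop) (𝓝 ((a (N, j) - a (N, j)) ^ 2)) := fun j =>
      (((h1 j).comp tendsto_fst).sub ((h1 j).comp tendsto_snd)).pow 2
    have h3 := (tendsto_finsetSum (Finset.range N) fun j _ => h2 j).const_mul (N:ℝ)
    simpa using h3
  have t2 := t1.eventually (gt_mem_nhds (half_pos hε))
  rw [prod_atTop_atTop_eq] at t2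
  obtain ⟨⟨k1, k2⟩, h⟩ := eventually_atTop.1 t2
  refine ⟨max k1 k2, fun k hk l hl => ?_⟩
  have h' := h (k, l) ⟨(le_max_left _ _).trans hk, (le_max_right _ _).trans hl⟩
  have hd := memX_sub (hu (g k)) (hu (g l))
  have := partition_ineq hd hN0
  have hG := gagSq_sub_le (hu (g k)) (hu (g l))
  have hG2 : gagSq (fun x => u (g k) x - u (g l) x) ≤ 4 * R := by
    linarith [hR (g k), hR (g l)]
  have b1 : 1 / (2 * (N:ℝ)) * gagSq (fun x => u (g k) x - u (g l) x) ≤ ε / 2 := by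
    rw [one_div, inv_mul_le_iff₀ (by positivity)]
    rw [div_lt_iff₀ hε] at hN
    linarith
  have b2 : ∀ j : ℕ, ∫ x in Ioc ((j:ℝ) / N) ((j + 1 : ℝ) / N), (u (g k) x - u (g l) x)
      = X (g k) (N, j) - X (g l) (N, j) := by
    intro j
    exact integral_sub (intOn_of_sq (hu _).1.1 (hu _).1.2.1 _ _)
      (intOn_of_sq (hu _).1.1 (hu _).1.2.1 _ _)
  simp_rw [b2] at this
  simp only at h'
  linarith

lemma complete_X {v : ℕ → ℝ → ℝ} (hv : ∀ n, memX (v n))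
    (h2 : ∀ ε > 0, ∃ k₀, ∀ k ≥ k₀, ∀ l ≥ k₀, ∫ x in Ioo (0:ℝ) 1, (v k x - v l x) ^ 2 < ε)
    (hG : ∀ ε > 0, ∃ k₀, ∀ k ≥ k₀, ∀ l ≥ k₀, gagSq (fun x => v k x - v l x) ≤ ε) :
    ∃ w, memX w ∧ Tendsto (fun k => gagNorm (fun x => v k x - w x)) atTop (𝓝 0) := by
  have hL : ∀ n, MemLp (v n) 2 volume := fun n =>
    (memLp_two_iff_integrable_sq (hv n).1.1.aestronglyMeasurable).2 (hv n).1.2.1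
  let V : ℕ → Lp ℝ 2 (volume : Measure ℝ) := fun n => (hL n).toLp (v n)
  have hdist : ∀ k l, dist (V k) (V l) = Real.sqrt (∫ x in Ioo (0:ℝ) 1, (v k x - v l x) ^ 2) := by
    intro k l
    rw [dist_eq_norm, ← MemLp.toLp_sub, Lp.norm_toLp,
      MemLp.eLpNorm_eq_integral_rpow_norm (by norm_num) (by norm_num) ((hL k).sub (hL l)),
      ENNReal.toReal_ofReal (by positivity), ← integral_sq_eq (memX_sub (hv k) (hv l)),
      Real.sqrt_eq_rpow]
    norm_num
  have hcau : CauchySeq V := by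
    rw [Metric.cauchySeq_iff]
    intro ε hε
    obtain ⟨k₀, h⟩ := h2 (ε ^ 2) (by positivity)
    refine ⟨k₀, fun k hk l hl => ?_⟩
    rw [hdist, Real.sqrt_lt' hε]
    exact h k hk l hl
  obtain ⟨W, hW⟩ := cauchySeq_tendsto_of_complete hcau
  obtain ⟨ns, hns, hae⟩ := (tendstoInMeasure_of_tendsto_Lp hW).exists_seq_tendsto_ae
  set w : ℝ → ℝ := fun x => W x with hw
  have wm : Measurable w := (Lp.stronglyMeasurable W).measurable
  have wL : MemLp w 2 volume := Lp.memLp W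
  have hae' : ∀ᵐ x : ℝ, Tendsto (fun i => v (ns i) x) atTop (𝓝 (w x)) := by
    have : ∀ᵐ x : ℝ, ∀ n, V n x = v n x := ae_all_iff.2 fun n => (hL n).coeFn_toLp
    filter_upwards [hae, this] with x hx hx'
    simpa only [hx'] using hx
  have hzero : ∀ᵐ x : ℝ, x ∉ Ioo (0 : ℝ) 1 → w x = 0 := by
    have : ∀ᵐ x : ℝ, ∀ n, x ∉ Ioo (0 : ℝ) 1 → v n x = 0 := ae_all_iff.2 fun n => (hv n).2
    filter_upwards [hae', this] with x hx hx' hxx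
    have : Tendsto (fun i => v (ns i) x) atTop (𝓝 0) := by
      simp [fun n => hx' n hxx]
    exact tendsto_nhds_unique hx this
  have hprod : ∀ᵐ p : ℝ × ℝ, Tendsto (fun i => v (ns i) p.1) atTop (𝓝 (w p.1)) ∧
      Tendsto (fun i => v (ns i) p.2) atTop (𝓝 (w p.2)) := by
    rw [Measure.volume_eq_prod]
    exact (Measure.quasiMeasurePreserving_fst.ae hae').and
      (Measure.quasiMeasurePreserving_snd.ae hae')
  have fatou : ∀ ε > 0, ∃ k₀, ∀ k ≥ k₀,
      ∫⁻ p, ENNReal.ofReal (gagKer (fun x => v k x - w x) p) ≤ ENNReal.ofReal ε := by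
    intro ε hε
    obtain ⟨k₀, h⟩ := hG ε hε
    refine ⟨k₀, fun k hk => ?_⟩
    calc ∫⁻ p, ENNReal.ofReal (gagKer (fun x => v k x - w x) p)
        = ∫⁻ p, liminf (fun i => ENNReal.ofReal
            (gagKer (fun x => v k x - v (ns i) x) p)) atTop := by
          apply lintegral_congr_ae
          filter_upwards [hprod] with p hp
          refine (Tendsto.liminf_eq ?_).symm
          refine (ENNReal.continuous_ofReal.tendsto _).comp ?_
          unfold gagKer
          exact (((tendsto_const_nhds.sub hp.1).sub (tendsto_const_nhds.sub hp.2)).pow 2).div_const _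
      _ ≤ liminf (fun i => ∫⁻ p, ENNReal.ofReal
            (gagKer (fun x => v k x - v (ns i) x) p)) atTop :=
          lintegral_liminf_le fun i =>
            (gagKer_meas (memX_sub (hv k) (hv (ns i))).1.1).ennreal_ofReal
      _ ≤ ENNReal.ofReal ε := by
          apply liminf_le_of_frequently_le'
          apply Eventually.frequently
          filter_upwards [eventually_ge_atTop k₀] with i hi
          rw [← ofReal_integral_eq_lintegral_ofReal (memX_sub (hv k) (hv (ns i))).1.2.2
            (ae_of_all _ (gagKer_nonneg _))]
          exact ENNReal.ofReal_le_ofReal (h k hk (ns i) (hi.trans (hns.id_le i)))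
  have hintg : ∀ k, ∫⁻ p, ENNReal.ofReal (gagKer (fun x => v k x - w x) p) < ⊤ →
      Integrable (gagKer (fun x => v k x - w x)) := by
    intro k hk
    have := (hv k).1.1
    refine ⟨(gagKer_meas (by fun_prop)).aestronglyMeasurable, ?_⟩
    rw [hasFiniteIntegral_iff_ofReal (ae_of_all _ (gagKer_nonneg _))]
    exact hk
  have wX : memX w := by
    refine ⟨⟨wm, (memLp_two_iff_integrable_sq wm.aestronglyMeasurable).1 wL, ?_⟩, hzero⟩
    obtain ⟨k, hk⟩ := fatou 1 one_pos
    have i1 := hintg k ((hk k le_rfl).trans_lt ENNReal.ofReal_lt_top)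
    refine Integrable.mono' (((hv k).1.2.2.const_mul 2).add (i1.const_mul 2))
      (gagKer_meas wm).aestronglyMeasurable (ae_of_all _ fun p => ?_)
    rw [Real.norm_of_nonneg (gagKer_nonneg _ _)]
    have := gagKer_sub_le (v k) (fun x => v k x - w x) p
    simpa using this
  refine ⟨w, wX, ?_⟩
  rw [Metric.tendsto_atTop]
  intro ε hε
  obtain ⟨k₀, h⟩ := fatou ((ε / 2) ^ 2) (by positivity)
  refine ⟨k₀, fun k hk => ?_⟩
  have h' := h k hk
  rw [← ofReal_integral_eq_lintegral_ofReal (memX_sub (hv k) wX).1.2.2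
    (ae_of_all _ (gagKer_nonneg _)), ENNReal.ofReal_le_ofReal_iff (by positivity)] at h'
  have : gagNorm (fun x => v k x - w x) ≤ ε / 2 := Real.sqrt_le_iff.2 ⟨by positivity, h'⟩
  rw [Real.dist_eq, sub_zero, abs_of_nonneg (show 0 ≤ gagNorm _ from Real.sqrt_nonneg _)]
  linarith

lemma pair_bound {h d : ℝ → ℝ} (ih : IntegrableOn (fun x => h x ^ 2) (Ioo 0 1))
    (id : IntegrableOn (fun x => d x ^ 2) (Ioo 0 1)) {δ K D : ℝ} (hδ : 0 < δ)
    (hK : ∫ x in Ioo (0:ℝ) 1, h x ^ 2 ≤ K) (hD : ∫ x in Ioo (0:ℝ) 1, d x ^ 2 ≤ D) :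
    |∫ x in Ioo (0:ℝ) 1, h x * d x| ≤ δ * K + δ⁻¹ * D := by
  have hi : Integrable (fun x => δ * h x ^ 2 + δ⁻¹ * d x ^ 2) (volume.restrict (Ioo 0 1)) :=
    (ih.const_mul δ).add (id.const_mul δ⁻¹)
  calc |∫ x in Ioo (0:ℝ) 1, h x * d x|
      ≤ ∫ x in Ioo (0:ℝ) 1, (δ * h x ^ 2 + δ⁻¹ * d x ^ 2) := by
        rw [← Real.norm_eq_abs]
        refine norm_integral_le_of_norm_le hi (ae_of_all _ fun x => ?_)
        have e : δ * h x ^ 2 + δ⁻¹ * d x ^ 2 = δ⁻¹ * ((δ * h x) ^ 2 + d x ^ 2) := by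
          field_simp
        rw [Real.norm_eq_abs, e, le_inv_mul_iff₀ hδ, ← abs_of_pos hδ, ← abs_mul, abs_of_pos hδ,
          abs_le]
        constructor <;> nlinarith [sq_nonneg (δ * h x + d x), sq_nonneg (δ * h x - d x),
          sq_nonneg (δ * h x), sq_nonneg (d x)]
    _ = δ * (∫ x in Ioo (0:ℝ) 1, h x ^ 2) + δ⁻¹ * ∫ x in Ioo (0:ℝ) 1, d x ^ 2 := by
        rw [integral_add (ih.const_mul δ) (id.const_mul δ⁻¹), integral_const_mul,
          integral_const_mul]
    _ ≤ _ := by gcongr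

/-- the Palais–Smale condition holds at every level (Lemma 3.1). -/
theorem statement10 (ω : ℝ) (hω0 : 0 < ω) (hωπ : ω ≤ π) (hTM : TMprop ω)
    (f : ℝ → ℝ) (hf : HypH f) :
    ∀ c : ℝ, PalaisSmaleAt f c := by
  intro c u hu hphi ⟨ε, hε, hder⟩
  obtain ⟨A, hA⟩ := hphi.bddAbove_range
  obtain ⟨E, hE⟩ := hε.bddAbove_range
  have hA' : ∀ n, phi f (u n) ≤ A := fun n => hA ⟨n, rfl⟩
  have hE' : ∀ n, ε n ≤ max E 0 := fun n => (hE ⟨n, rfl⟩).trans (le_max_left _ _)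
  obtain ⟨R, hR, hbd⟩ := ps_bounded hω0 hTM hf A (max E 0) (le_max_right _ _)
  have hR' : ∀ n, gagNorm (u n) ≤ R := fun n =>
    hbd (u n) (hu n) (hA' n) fun v hv hv1 => (hder n v hv hv1).trans (hE' n)
  have hR2 : ∀ n, gagSq (u n) ≤ R ^ 2 := fun n => by
    rw [← gagNorm_sq]; exact pow_le_pow_left₀ (Real.sqrt_nonneg _) (hR' n) 2
  obtain ⟨K, hK, hKb⟩ := sq_bounds hω0 hTM hf hR
  obtain ⟨g, hg, hcau⟩ := compact_emb hu hR2 fun n => (hKb (u n) (hu n) (hR' n)).1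
  have hπ := Real.pi_pos
  have hεg : Tendsto (fun k => ε (g k)) atTop (𝓝 0) := hε.comp hg.tendsto_atTop
  obtain ⟨w, hw, hlim⟩ := complete_X (v := fun k => u (g k)) (fun k => hu (g k)) hcau (by
    intro η hη
    -- choose parameters
    set κ := η / (2 * π) with hκ
    have hκ0 : 0 < κ := by positivity
    set δ := κ / (8 * K) with hδ
    have hδ0 : 0 < δ := by positivity
    obtain ⟨k1, h1⟩ := hcau (δ * κ / 8) (by positivity)
    obtain ⟨k2, h2⟩ := eventually_atTop.1
      (hεg.eventually (gt_mem_nhds (show (0:ℝ) < κ / (8 * R) by positivity)))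
    refine ⟨max k1 k2, fun k hk l hl => ?_⟩
    have hd := memX_sub (hu (g k)) (hu (g l))
    have hD := (h1 k ((le_max_left _ _).trans hk) l ((le_max_left _ _).trans hl)).le
    have hek := h2 k ((le_max_right _ _).trans hk)
    have hel := h2 l ((le_max_right _ _).trans hl)
    have hdR : gagNorm (fun x => u (g k) x - u (g l) x) ≤ 2 * R := by
      refine Real.sqrt_le_iff.2 ⟨by positivity, ?_⟩
      have := gagSq_sub_le (hu (g k)) (hu (g l))
      linarith [hR2 (g k), hR2 (g l)]
    have dk := phiDeriv_bound (hder (g k)) hd (R := 2 * R) (by positivity) hdR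
    have dl := phiDeriv_bound (hder (g l)) hd (R := 2 * R) (by positivity) hdR
    obtain ⟨-, ik, bk⟩ := hKb (u (g k)) (hu _) (hR' _)
    obtain ⟨-, il, bl⟩ := hKb (u (g l)) (hu _) (hR' _)
    have pk := pair_bound ik hd.1.2.1.integrableOn hδ0 bk hD
    have pl := pair_bound il hd.1.2.1.integrableOn hδ0 bl hD
    have eq := innerX_sub_sub (hu (g k)) (hu (g l))
    have s1 : δ * K + δ⁻¹ * (δ * κ / 8) = κ / 4 := by
      rw [hδ]; field_simp; ring
    have s2 : ∀ e, e < κ / (8 * R) → e * (2 * R) ≤ κ / 4 := by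
      intro e he
      rw [lt_div_iff₀ (by positivity)] at he
      linarith
    rw [s1] at pk pl
    unfold phiDeriv at dk dl
    have dk' := (abs_le.1 (dk.trans (s2 _ hek))).2
    have dl' := (abs_le.1 (dl.trans (s2 _ hel))).1
    have pk' := (abs_le.1 pk).2
    have pl' := (abs_le.1 pl).1
    have fin : gagSq (fun x => u (g k) x - u (g l) x) / (2 * π) ≤ κ := by
      rw [← eq, sub_div]
      linarith
    rw [hκ] at fin
    exact (div_le_div_iff_of_pos_right (by positivity)).1 fin)
  exact ⟨w, hw, g, hg, hlim⟩
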